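/- Let λ, ω ∈ ℝ with ω ≠ 0, set μ₀(t) = cos(ωt)·sinh(λt) + sin(ωt)·cosh(λt), and let I ⊆ ℝ be an open interval on which μ₀(t) ≠ 0. Let ν : I → ℂ be differentiable with ν(t)²·(2πi·μ₀(t)) = 1 for all t ∈ I, and define G(x,y,t) = ν(t)·exp( ((x² − y²)·sin(ωt)·sinh(λt) + 2xy − (x² + y²)·cos(ωt)·cosh(λt)) / (2i·μ₀(t)) ). Then for all x, y ∈ ℝ and t ∈ I, G satisfies the Schrödinger equation of the degenerate parametric oscillator: i·∂ₜG = −(1/2)·(ω + λ·cos(2ωt))·∂ₓ²G + (1/2)·(ω − λ·cos(2ωt))·x²·G − i·λ·sin(2ωt)·x·∂ₓG − i·(λ/2)·sin(2ωt)·G. -/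

import Mathlib

/-- The propagator of the degenerate parametric oscillator:
`G(x,y,t) = (2πiμ₀(t))^{-1/2} exp(((x²-y²) sin ωt sinh λt + 2xy
- (x²+y²) cos ωt cosh λt)/(2iμ₀(t)))` with
`μ₀(t) = cos ωt sinh λt + sin ωt cosh λt` satisfies
`i∂ₜG = -(1/2)(ω + λ cos 2ωt)∂ₓ²G + (1/2)(ω - λ cos 2ωt)x²G
- iλ sin(2ωt) x ∂ₓG - i(λ/2) sin(2ωt) G`. -/
theorem stmt_9 (lam ω : ℝ) (hω : ω ≠ 0)
    (μ₀ : ℝ → ℝ)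
    (hμ₀ : ∀ t : ℝ, μ₀ t =
      Real.cos (ω * t) * Real.sinh (lam * t) + Real.sin (ω * t) * Real.cosh (lam * t))
    (I : Set ℝ) (hI : IsOpen I) (hIconn : I.OrdConnected)
    (hμ₀ne : ∀ t ∈ I, μ₀ t ≠ 0)
    (ν : ℝ → ℂ)
    (hν : ∀ t ∈ I, DifferentiableAt ℝ ν t)
    (hν2 : ∀ t ∈ I, ν t ^ 2 * (2 * (Real.pi : ℂ) * Complex.I * (μ₀ t : ℂ)) = 1)
    (G : ℝ → ℝ → ℝ → ℂ)
    (hG : ∀ (x y t : ℝ), G x y t =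
      ν t * Complex.exp (
        ((((x ^ 2 - y ^ 2) * (Real.sin (ω * t) * Real.sinh (lam * t))
            + 2 * x * y
            - (x ^ 2 + y ^ 2) * (Real.cos (ω * t) * Real.cosh (lam * t))) : ℝ) : ℂ)
          / (2 * Complex.I * (μ₀ t : ℂ)))) :
    ∀ (x y : ℝ), ∀ t ∈ I,
      Complex.I * deriv (fun s : ℝ => G x y s) t =
        -((1 / 2 : ℂ) * ((ω : ℂ) + (lam : ℂ) * (Real.cos (2 * ω * t) : ℂ)))
            * deriv (fun u : ℝ => deriv (fun u' : ℝ => G u' y t) u) x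
          + (1 / 2 : ℂ) * ((ω : ℂ) - (lam : ℂ) * (Real.cos (2 * ω * t) : ℂ))
            * (x : ℂ) ^ 2 * G x y t
          - Complex.I * (lam : ℂ) * (Real.sin (2 * ω * t) : ℂ) * (x : ℂ)
            * deriv (fun u : ℝ => G u y t) x
          - Complex.I * ((lam : ℂ) / 2) * (Real.sin (2 * ω * t) : ℂ) * G x y t := by
  intro x y t ht
  have hμne : μ₀ t ≠ 0 := hμ₀ne t ht
  have hμc : ((μ₀ t : ℝ) : ℂ) ≠ 0 := by exact_mod_cast hμne
  have hI2 : Complex.I ^ 2 = -1 := Complex.I_sq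
  have hI0 : Complex.I ≠ 0 := Complex.I_ne_zero
  -- trigonometric derivatives
  have hωt : HasDerivAt (fun r : ℝ => ω * r) ω t := by
    simpa using (hasDerivAt_id t).const_mul ω
  have hlt : HasDerivAt (fun r : ℝ => lam * r) lam t := by
    simpa using (hasDerivAt_id t).const_mul lam
  have hc := hωt.cos
  have hs := hωt.sin
  have hC := hlt.cosh
  have hS := hlt.sinh
  have hμd : HasDerivAt μ₀ ((ω + lam) * (Real.cos (ω * t) * Real.cosh (lam * t))
      + (lam - ω) * (Real.sin (ω * t) * Real.sinh (lam * t))) t := by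
    have h := (hc.mul hS).add (hs.mul hC)
    have he : μ₀ = (fun r => Real.cos (ω * r)) * (fun r => Real.sinh (lam * r))
        + (fun r => Real.sin (ω * r)) * (fun r => Real.cosh (lam * r)) := by
      funext r; simp [hμ₀ r]
    rw [he]
    refine HasDerivAt.congr_deriv (show HasDerivAt _ _ _ from h) ?_
    ring
  have hNd : HasDerivAt (fun r : ℝ => (x ^ 2 - y ^ 2) * (Real.sin (ω * r) * Real.sinh (lam * r))
            + 2 * x * y
            - (x ^ 2 + y ^ 2) * (Real.cos (ω * r) * Real.cosh (lam * r)))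
      ((x ^ 2 - y ^ 2) * (ω * (Real.cos (ω * t) * Real.sinh (lam * t))
          + lam * (Real.sin (ω * t) * Real.cosh (lam * t)))
        - (x ^ 2 + y ^ 2) * (-ω * (Real.sin (ω * t) * Real.cosh (lam * t))
          + lam * (Real.cos (ω * t) * Real.sinh (lam * t)))) t := by
    have h := (((hs.mul hS).const_mul (x ^ 2 - y ^ 2)).add_const (2 * x * y)).sub
      ((hc.mul hC).const_mul (x ^ 2 + y ^ 2))
    refine HasDerivAt.congr_deriv (show HasDerivAt _ _ _ from h) ?_
    ring
  have hcs : Real.sin (ω * t) ^ 2 + Real.cos (ω * t) ^ 2 = 1 := Real.sin_sq_add_cos_sq _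
  have hCS : Real.cosh (lam * t) ^ 2 - Real.sinh (lam * t) ^ 2 = 1 := Real.cosh_sq_sub_sinh_sq _
  have hc2 : Real.cos (2 * ω * t) = Real.cos (ω * t) ^ 2 - Real.sin (ω * t) ^ 2 := by
    rw [mul_assoc, Real.cos_two_mul]; linarith
  have hs2 : Real.sin (2 * ω * t) = 2 * Real.sin (ω * t) * Real.cos (ω * t) := by
    rw [mul_assoc, Real.sin_two_mul]
  have hμt := hμ₀ t
  have hν2t := hν2 t ht
  have hGx : ∀ u : ℝ, HasDerivAt (fun u' : ℝ => G u' y t)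
      (((2 * (u * (Real.sin (ω * t) * Real.sinh (lam * t)
        - Real.cos (ω * t) * Real.cosh (lam * t)) + y) : ℝ) : ℂ)
        / (2 * Complex.I * (μ₀ t : ℂ)) * G u y t) u := by
    intro u
    have hp : HasDerivAt (fun u' : ℝ =>
        (u' ^ 2 - y ^ 2) * (Real.sin (ω * t) * Real.sinh (lam * t))
            + 2 * u' * y
            - (u' ^ 2 + y ^ 2) * (Real.cos (ω * t) * Real.cosh (lam * t)))
        (2 * (u * (Real.sin (ω * t) * Real.sinh (lam * t)
        - Real.cos (ω * t) * Real.cosh (lam * t)) + y)) u := by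
      have h1 := hasDerivAt_id' u
      have h2 := h1.pow 2
      have h := (((h2.sub_const (y ^ 2)).mul_const
        (Real.sin (ω * t) * Real.sinh (lam * t))).add ((h1.const_mul 2).mul_const y)).sub
        ((h2.add_const (y ^ 2)).mul_const (Real.cos (ω * t) * Real.cosh (lam * t)))
      refine HasDerivAt.congr_deriv (show HasDerivAt _ _ _ from h) ?_
      push_cast; ring
    have h := ((hp.ofReal_comp.div_const (2 * Complex.I * (μ₀ t : ℂ))).cexp).const_mul (ν t)
    have he : (fun u' : ℝ => G u' y t) = _ := funext fun u' => hG u' y t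
    rw [he, hG u y t]
    refine HasDerivAt.congr_deriv (show HasDerivAt _ _ _ from h) ?_
    ring
  have hGx1 : ∀ u : ℝ, deriv (fun u' : ℝ => G u' y t) u = _ := fun u => (hGx u).deriv
  have hGxx : HasDerivAt (fun u : ℝ => deriv (fun u' : ℝ => G u' y t) u)
      (((2 * (Real.sin (ω * t) * Real.sinh (lam * t)
        - Real.cos (ω * t) * Real.cosh (lam * t)) : ℝ) : ℂ)
        / (2 * Complex.I * (μ₀ t : ℂ)) * G x y t +
        (((2 * (x * (Real.sin (ω * t) * Real.sinh (lam * t)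
        - Real.cos (ω * t) * Real.cosh (lam * t)) + y) : ℝ) : ℂ)
        / (2 * Complex.I * (μ₀ t : ℂ))) ^ 2 * G x y t) x := by
    have hl : HasDerivAt (fun u : ℝ => 2 * (u * (Real.sin (ω * t) * Real.sinh (lam * t)
        - Real.cos (ω * t) * Real.cosh (lam * t)) + y))
        (2 * (Real.sin (ω * t) * Real.sinh (lam * t)
        - Real.cos (ω * t) * Real.cosh (lam * t))) x := by
      have h := ((((hasDerivAt_id' x).mul_const (Real.sin (ω * t) * Real.sinh (lam * t)
        - Real.cos (ω * t) * Real.cosh (lam * t))).add_const y).const_mul 2)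
      refine HasDerivAt.congr_deriv (show HasDerivAt _ _ _ from h) ?_
      ring
    have h := (hl.ofReal_comp.div_const (2 * Complex.I * (μ₀ t : ℂ))).mul (hGx x)
    rw [funext hGx1]
    refine HasDerivAt.congr_deriv (show HasDerivAt _ _ _ from h) ?_
    ring
  -- derivative of ν
  have hνd := (hν t ht).hasDerivAt
  have hν0 : ν t ≠ 0 := by
    intro h0; rw [h0] at hν2t; simp at hν2t
  have hν' : 2 * deriv ν t * (μ₀ t : ℂ) = - ν t *
      (((ω + lam) * (Real.cos (ω * t) * Real.cosh (lam * t))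
      + (lam - ω) * (Real.sin (ω * t) * Real.sinh (lam * t)) : ℝ) : ℂ) := by
    have h := (hνd.pow 2).mul (hμd.ofReal_comp.const_mul (2 * (Real.pi : ℂ) * Complex.I))
    have hev : (ν ^ 2 * fun r : ℝ => (2 * (Real.pi : ℂ) * Complex.I) * (μ₀ r : ℂ))
        =ᶠ[nhds t] fun _ => (1 : ℂ) := by
      filter_upwards [hI.mem_nhds ht] with r hr
      simpa using hν2 r hr
    have h1 := (h.congr_of_eventuallyEq hev.symm).unique (hasDerivAt_const t (1 : ℂ))
    have hpi : (Real.pi : ℂ) ≠ 0 := by exact_mod_cast Real.pi_ne_zero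
    have hk : ν t * (2 * (Real.pi : ℂ) * Complex.I) ≠ 0 := by
      simp [hν0, hpi]
    apply mul_left_cancel₀ hk
    simp only [Pi.pow_apply] at h1
    norm_num at h1
    push_cast at h1 ⊢
    linear_combination h1
  have h := hνd.mul ((hNd.ofReal_comp.div (hμd.ofReal_comp.const_mul (2 * Complex.I))
      (by simp [hμc])).cexp)
  have hGt := h.congr_of_eventuallyEq (f₁ := fun r : ℝ => G x y r)
    (Filter.Eventually.of_forall fun r => hG x y r)
  clear h
  rw [hGt.deriv, hGxx.deriv, hGx1 x, hG x y t, hc2, hs2]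
  simp only [Pi.div_apply]
  generalize hE : Complex.exp _ = E
  clear hE hGt hGxx hGx1 hGx hG hNd hμd hc hs hC hS hνd hν2 hν2t
  generalize Real.cos (ω * t) = c at *
  generalize Real.sin (ω * t) = s at *
  generalize Real.cosh (lam * t) = C at *
  generalize Real.sinh (lam * t) = S at *
  generalize μ₀ t = m at *
  generalize deriv ν t = n' at *
  generalize ν t = n at *
  have hn : n' = - n * (((ω + lam) * (c * C) + (lam - ω) * (s * S) : ℝ) : ℂ) / (2 * (m : ℂ)) := by
    field_simp
    push_cast at hν' ⊢
    linear_combination hν'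
  have him : -((ω + lam) * (c * C) + (lam - ω) * (s * S)) =
      (ω + lam * (c ^ 2 - s ^ 2)) * (s * S - c * C) - lam * (2 * s * c) * m := by
    rw [hμt]; grind
  have hre : ((x ^ 2 - y ^ 2) * (ω * (c * S) + lam * (s * C))
        - (x ^ 2 + y ^ 2) * (-ω * (s * C) + lam * (c * S))) * m
      - ((x ^ 2 - y ^ 2) * (s * S) + 2 * x * y - (x ^ 2 + y ^ 2) * (c * C)) *
        ((ω + lam) * (c * C) + (lam - ω) * (s * S)) =
      (ω + lam * (c ^ 2 - s ^ 2)) * (x * (s * S - c * C) + y) ^ 2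
      + (ω - lam * (c ^ 2 - s ^ 2)) * x ^ 2 * m ^ 2
      - 2 * lam * (2 * s * c) * x * (x * (s * S - c * C) + y) * m := by
    have ha : (ω - lam) * (c * S) + (ω + lam) * (s * C) =
        (ω - lam * (c ^ 2 - s ^ 2)) * m - lam * (2 * s * c) * (s * S - c * C) := by
      rw [hμt]; grind
    have hb : ((ω + lam) * (c * S) + (lam - ω) * (s * C)) * m
        - (s * S + c * C) * ((ω + lam) * (c * C) + (lam - ω) * (s * S))
        = -(ω + lam * (c ^ 2 - s ^ 2)) := by
      rw [hμt]; grind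
    linear_combination x ^ 2 * m * ha - y ^ 2 * hb
      + (x ^ 2 * (s * S - c * C) + 2 * x * y) * him
  have himc := congrArg (fun r : ℝ => (r : ℂ)) him
  have hrec := congrArg (fun r : ℝ => (r : ℂ)) hre
  rw [hn]
  push_cast at himc hrec ⊢
  field_simp
  linear_combination Complex.I ^ 2 * E * hrec + Complex.I ^ 3 * E * m * himc
    + E * ((ω + lam * (c ^ 2 - s ^ 2)) * (x * (s * S - c * C) + y) ^ 2
      + Complex.I * m * (ω + lam * (c ^ 2 - s ^ 2)) * (s * S - c * C)) * hI2
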